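/- Let n ≥ 1 and d ≥ 1 be natural numbers. For every k ∈ ℕ and all hermitian complex k×k matrices X_1, …, X_n, one has H_{2d}(X_1, …, X_n) ⪰ μ_{n,d} · (X_1^{2d} + ⋯ + X_n^{2d}) in the Löwner order. -/

import Mathlib

open Matrix BigOperators ComplexOrder

/-- Product of ring elements along a word `w : Fin d → Fin n`:
`X_{w 0} * X_{w 1} * ⋯ * X_{w (d-1)}`. -/
noncomputable def wordProd {R : Type*} [Monoid R] {n d : ℕ} (X : Fin n → R)
    (w : Fin d → Fin n) : R :=
  (List.ofFn fun i => X (w i)).prod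

/-- Number of occurrences of the letter `j` in the word `w`. -/
def letterCount {n d : ℕ} (w : Fin d → Fin n) (j : Fin n) : ℕ :=
  (Finset.univ.filter fun i => w i = j).card

/-- Coefficient of the word `w` in the NCHS polynomial of degree `d`:
`(∏_j k_j(w)!) / d!`. -/
noncomputable def nchsCoeff {n : ℕ} (d : ℕ) (w : Fin d → Fin n) : ℝ :=
  ((∏ j : Fin n, (letterCount w j).factorial : ℕ) : ℝ) / (d.factorial : ℝ)

/-- The noncommutative complete homogeneous symmetric polynomial of degree `d`
evaluated at `X`. -/
noncomputable def nchs {R : Type*} [Ring R] [Module ℝ R] {n : ℕ} (d : ℕ)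
    (X : Fin n → R) : R :=
  ∑ w : Fin d → Fin n, nchsCoeff d w • wordProd X w

/-- The optimal constant `μ_{n,d}`. -/
noncomputable def muConst (n d : ℕ) : ℝ :=
  if n = 1 then 1 else
    ((n - 1 + 2 * d).choose (2 * d) : ℝ) /
      (((n - 1 + d).choose d : ℝ) *
        (((n - 1 + d).choose d : ℝ) + if Odd d then 1 else ((n - 1 : ℕ) : ℝ)))

/-- The rising factorial `x (x + 1) ⋯ (x + k - 1)`. -/
noncomputable def risingFactorial (x : ℝ) (k : ℕ) : ℝ := ∏ i ∈ Finset.range k, (x + i)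

lemma risingFactorial_zero (x : ℝ) : risingFactorial x 0 = 1 := by
  simp [risingFactorial]

lemma risingFactorial_succ (x : ℝ) (k : ℕ) :
    risingFactorial x (k + 1) = risingFactorial x k * (x + k) := by
  simp [risingFactorial, Finset.prod_range_succ]

lemma risingFactorial_succ' (x : ℝ) (k : ℕ) :
    risingFactorial x (k + 1) = x * risingFactorial (x + 1) k := by
  simp only [risingFactorial, Finset.prod_range_succ']
  rw [mul_comm]
  congr 1
  · simp
  · refine Finset.prod_congr rfl fun i _ => ?_
    push_cast
    ring

lemma risingFactorial_add (x : ℝ) (k l : ℕ) :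
    risingFactorial x (k + l) = risingFactorial x k * risingFactorial (x + k) l := by
  simp only [risingFactorial, Finset.prod_range_add]
  congr 1
  refine Finset.prod_congr rfl fun i _ => ?_
  push_cast
  ring

lemma risingFactorial_neg_natCast (a k : ℕ) :
    risingFactorial (-a) k = (-1) ^ k * a.choose k * k.factorial := by
  induction k with
  | zero => simp [risingFactorial_zero]
  | succ k ih =>
    have h : ((a.choose (k + 1) : ℕ) : ℝ) * (k + 1) = a.choose k * (a - k) := by
      rcases le_or_gt k a with h | h
      · have := Nat.choose_succ_right_eq a k
        rw [← Nat.cast_sub h]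
        exact_mod_cast this
      · simp [Nat.choose_eq_zero_of_lt h, Nat.choose_eq_zero_of_lt (h.trans (Nat.lt_succ_self k))]
    rw [risingFactorial_succ, ih, Nat.factorial_succ]
    push_cast
    linear_combination (-1) ^ k * k.factorial * h

/-- The Chu–Vandermonde identity for rising factorials. -/
lemma sum_choose_mul_risingFactorial (x y : ℝ) (d : ℕ) :
    ∑ p ∈ Finset.HasAntidiagonal.antidiagonal d,
      (d.choose p.1 : ℝ) * (risingFactorial x p.1 * risingFactorial y p.2) =
      risingFactorial (x + y) d := by
  induction d with
  | zero => simp [risingFactorial_zero]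
  | succ d ih =>
    rw [Finset.sum_antidiagonal_choose_succ_mul
      (fun i j => risingFactorial x i * risingFactorial y j), ← Finset.sum_add_distrib,
      risingFactorial_succ, ← ih, Finset.sum_mul]
    refine Finset.sum_congr rfl fun p hp => ?_
    have hp' := Finset.HasAntidiagonal.mem_antidiagonal.mp hp
    have h : d.choose p.2 = d.choose p.1 := Nat.choose_symm_of_eq_add (by omega)
    have hd : (d : ℝ) = p.1 + p.2 := by exact_mod_cast hp'.symm
    rw [h, risingFactorial_succ, risingFactorial_succ, hd]
    ring

lemma sum_choose_mul_choose_mul_risingFactorial (x y : ℝ) {d r : ℕ} (hr : r ≤ d) :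
    ∑ p ∈ Finset.HasAntidiagonal.antidiagonal d,
      (d.choose p.1 : ℝ) * (p.1.choose r * (risingFactorial x p.1 * risingFactorial y p.2)) =
      d.choose r * (risingFactorial x r * risingFactorial (x + r + y) (d - r)) := by
  obtain ⟨e, rfl⟩ := Nat.exists_eq_add_of_le hr
  rw [Finset.Nat.sum_antidiagonal_eq_sum_range_succ_mk, Nat.succ_eq_add_one, add_assoc r e 1,
    Finset.sum_range_add,
    Finset.sum_eq_zero, zero_add, Nat.add_sub_cancel_left, ← sum_choose_mul_risingFactorial,
    Finset.Nat.sum_antidiagonal_eq_sum_range_succ_mk, Finset.mul_sum, Finset.mul_sum]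
  · refine Finset.sum_congr rfl fun j _ => ?_
    have h : (((r + e).choose (r + j) : ℕ) : ℝ) * ((r + j).choose r : ℕ) =
        (r + e).choose r * e.choose j := by
      have := Nat.choose_mul (n := r + e) (k := r + j) (s := r) (by omega)
      simp only [Nat.add_sub_cancel_left] at this
      exact_mod_cast this
    rw [risingFactorial_add, Nat.add_sub_add_left]
    linear_combination
      risingFactorial x r * risingFactorial (x + r) j * risingFactorial y (e - j) * h
  · intro j hj
    simp [Nat.choose_eq_zero_of_lt (Finset.mem_range.mp hj)]

lemma add_choose_eq_sum_range (a b : ℕ) {D : ℕ} (hb : b ≤ D) :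
    (a + b).choose b = ∑ r ∈ Finset.range (D + 1), a.choose r * b.choose r := by
  rw [Nat.add_choose_eq, Finset.Nat.sum_antidiagonal_eq_sum_range_succ_mk]
  have h : Finset.range (b + 1) ⊆ Finset.range (D + 1) := by
    simpa using hb
  rw [← Finset.sum_subset h]
  · refine Finset.sum_congr rfl fun r hr => ?_
    rw [Nat.choose_symm (by simpa [Nat.lt_succ_iff] using hr)]
  · intro r _ hr
    rw [Nat.choose_eq_zero_of_lt (n := b), mul_zero]
    simpa using hr

/-- A Pfaff–Saalschütz summation. -/
lemma sum_choose_mul_choose_mul_factorial (N : ℕ) {d m : ℕ} (hm : m ≤ d) :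
    ∑ p ∈ Finset.HasAntidiagonal.antidiagonal d, (d.choose p.1 : ℝ) *
      ((-1) ^ p.1 * N.choose p.1 * (p.1 + m).factorial * risingFactorial (N - m) p.2) =
      if m = d then (-1) ^ d * (d.factorial : ℝ) ^ 2 * (N + d).choose d else 0 := by
  have expand : ∀ p ∈ Finset.HasAntidiagonal.antidiagonal d, (d.choose p.1 : ℝ) *
      ((-1) ^ p.1 * N.choose p.1 * (p.1 + m).factorial * risingFactorial (N - m) p.2) =
      ∑ r ∈ Finset.range (m + 1), m.factorial * m.choose r * ((d.choose p.1 : ℝ) *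
        (p.1.choose r * (risingFactorial (-N) p.1 * risingFactorial (N - m) p.2))) := by
    intro p _
    have h : ((p.1 + m).factorial : ℝ) =
        ∑ r ∈ Finset.range (m + 1),
          (p.1.choose r : ℝ) * m.choose r * (p.1.factorial * m.factorial) := by
      rw [← Nat.add_choose_mul_factorial_mul_factorial, add_choose_eq_sum_range _ _ le_rfl]
      push_cast
      rw [mul_assoc, Finset.sum_mul]
    rw [h, risingFactorial_neg_natCast, Finset.mul_sum, Finset.sum_mul, Finset.mul_sum]
    refine Finset.sum_congr rfl fun r _ => ?_
    ring
  rw [Finset.sum_congr rfl expand, Finset.sum_comm]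
  have inner_sum : ∀ r ∈ Finset.range (m + 1), ∑ p ∈ Finset.HasAntidiagonal.antidiagonal d,
      (m.factorial * m.choose r * ((d.choose p.1 : ℝ) *
        (p.1.choose r * (risingFactorial (-N) p.1 * risingFactorial (N - m) p.2)))) =
      if m = d then (-1) ^ d * (d.factorial : ℝ) ^ 2 * (N.choose r * d.choose r) else 0 := by
    intro r hr
    have hr' : r ≤ m := by simpa [Nat.lt_succ_iff] using hr
    rw [← Finset.mul_sum, sum_choose_mul_choose_mul_risingFactorial _ _ (hr'.trans hm),
      show (-N + r + (N - m) : ℝ) = -((m - r : ℕ) : ℝ) by push_cast [hr']; ring,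
      risingFactorial_neg_natCast, risingFactorial_neg_natCast]
    split_ifs with h
    · subst h
      obtain ⟨e, rfl⟩ := Nat.exists_eq_add_of_le hr'
      have hf := Nat.add_choose_mul_factorial_mul_factorial r e
      have hf' : (((r + e).choose e : ℕ) : ℝ) * r.factorial * e.factorial = (r + e).factorial := by
        exact_mod_cast hf
      simp only [Nat.add_sub_cancel_left, Nat.choose_self, pow_add, Nat.cast_one]
      rw [← hf', Nat.choose_symm_add]
      ring
    · rw [Nat.choose_eq_zero_of_lt (n := m - r) (by omega)]
      simp
  rw [Finset.sum_congr rfl inner_sum]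
  split_ifs with h
  · subst h
    rw [← Finset.mul_sum, add_choose_eq_sum_range _ _ le_rfl]
    push_cast
    rfl
  · simp

lemma letterCount_eq_sum {n d : ℕ} (w : Fin d → Fin n) (j : Fin n) :
    letterCount w j = ∑ i, if w i = j then 1 else 0 := by
  rw [letterCount, Finset.card_filter]

lemma letterCount_cons {n d : ℕ} (a : Fin n) (w : Fin d → Fin n) (j : Fin n) :
    letterCount (Fin.cons a w : Fin (d + 1) → Fin n) j =
      letterCount w j + if a = j then 1 else 0 := by
  simp only [letterCount_eq_sum, Fin.sum_univ_succ, Fin.cons_zero, Fin.cons_succ]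
  exact add_comm _ _

lemma letterCount_append {n d e : ℕ} (u : Fin d → Fin n) (v : Fin e → Fin n) (j : Fin n) :
    letterCount (Fin.append u v) j = letterCount u j + letterCount v j := by
  simp only [letterCount_eq_sum, Fin.sum_univ_add, Fin.append_left, Fin.append_right]

lemma letterCount_comp_rev {n d : ℕ} (u : Fin d → Fin n) (j : Fin n) :
    letterCount (u ∘ Fin.rev) j = letterCount u j := by
  simp only [letterCount_eq_sum]
  exact Equiv.sum_comp Fin.revPerm fun i => if u i = j then 1 else 0

lemma sum_letterCount {n d : ℕ} (w : Fin d → Fin n) : ∑ j, letterCount w j = d := by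
  simp only [letterCount_eq_sum]
  rw [Finset.sum_comm]
  simp

lemma letterCount_le {n d : ℕ} (w : Fin d → Fin n) (j : Fin n) : letterCount w j ≤ d := by
  simpa [letterCount] using Finset.card_filter_le (Finset.univ : Finset (Fin d)) fun i => w i = j

lemma letterCount_const {n d : ℕ} (a j : Fin n) :
    letterCount (fun _ : Fin d => a) j = if a = j then d else 0 := by
  rw [letterCount_eq_sum]
  split_ifs <;> simp

lemma letterCount_eq_length_iff {n d : ℕ} (w : Fin d → Fin n) (j : Fin n) :
    letterCount w j = d ↔ w = fun _ => j := by
  constructor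
  · intro h
    have h' : (Finset.univ.filter fun i => w i = j).card = (Finset.univ : Finset (Fin d)).card := by
      simpa [letterCount] using h
    funext i
    simpa using Finset.card_filter_eq_iff.mp h' i
  · rintro rfl
    simp [letterCount_const]

/-- Summing products of shifted factorials of letter counts over all words, with a weight
depending on the number of occurrences of one distinguished letter. -/
lemma sum_words_weight_mul_prod_factorial {n d : ℕ} (i : Fin n) (g : ℕ → ℝ) (β : Fin n → ℕ) :
    ∑ u : Fin d → Fin n,
      g (letterCount u i) * ∏ l, ((letterCount u l + β l).factorial : ℝ) =
      (∑ p ∈ Finset.HasAntidiagonal.antidiagonal d, (d.choose p.1 : ℝ) *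
        (g p.1 * (p.1 + β i).factorial *
          risingFactorial (∑ l ∈ Finset.univ.erase i, (β l + 1 : ℝ)) p.2)) *
        ∏ l ∈ Finset.univ.erase i, ((β l).factorial : ℝ) := by
  induction d generalizing g β with
  | zero =>
    simp [letterCount, risingFactorial_zero, mul_assoc,
      Finset.mul_prod_erase Finset.univ (fun l => ((β l).factorial : ℝ)) (Finset.mem_univ i)]
  | succ d ih =>
    set B : ℝ := ∑ l ∈ Finset.univ.erase i, (β l + 1 : ℝ) with hB
    set P : ℝ := ∏ l ∈ Finset.univ.erase i, ((β l).factorial : ℝ) with hP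
    have cons_sum : ∑ u : Fin (d + 1) → Fin n,
        g (letterCount u i) * ∏ l, ((letterCount u l + β l).factorial : ℝ) =
        ∑ a : Fin n, ∑ u : Fin d → Fin n, g (letterCount u i + if a = i then 1 else 0) *
          ∏ l, ((letterCount u l + (β l + if a = l then 1 else 0)).factorial : ℝ) := by
      rw [← (Fin.consEquiv fun _ => Fin n).sum_comp, Fintype.sum_prod_type]
      refine Finset.sum_congr rfl fun a _ => Finset.sum_congr rfl fun u _ => ?_
      simp only [Fin.consEquiv, Equiv.coe_fn_mk, letterCount_cons]
      congr 1
      refine Finset.prod_congr rfl fun l _ => ?_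
      rw [add_right_comm, add_assoc]
    have at_self : ∑ u : Fin d → Fin n, g (letterCount u i + if i = i then 1 else 0) *
          ∏ l, ((letterCount u l + (β l + if i = l then 1 else 0)).factorial : ℝ) =
        (∑ p ∈ Finset.HasAntidiagonal.antidiagonal d, (d.choose p.1 : ℝ) *
          (g (p.1 + 1) * (p.1 + 1 + β i).factorial * risingFactorial B p.2)) * P := by
      rw [ih (fun k => g (k + if i = i then 1 else 0)) fun l => β l + if i = l then 1 else 0]
      have hsum : ∑ l ∈ Finset.univ.erase i, (((β l + if i = l then 1 else 0 : ℕ) : ℝ) + 1) = B :=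
        Finset.sum_congr rfl fun l hl => by simp [(Finset.ne_of_mem_erase hl).symm]
      have hprod : ∏ l ∈ Finset.univ.erase i,
          (((β l + if i = l then 1 else 0).factorial : ℕ) : ℝ) = P :=
        Finset.prod_congr rfl fun l hl => by simp [(Finset.ne_of_mem_erase hl).symm]
      rw [hsum, hprod]
      congr 1
      refine Finset.sum_congr rfl fun p _ => ?_
      simp [add_comm, add_left_comm]
    have at_ne : ∀ a ∈ Finset.univ.erase i,
        ∑ u : Fin d → Fin n, g (letterCount u i + if a = i then 1 else 0) *
          ∏ l, ((letterCount u l + (β l + if a = l then 1 else 0)).factorial : ℝ) =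
        (β a + 1) * ((∑ p ∈ Finset.HasAntidiagonal.antidiagonal d, (d.choose p.1 : ℝ) *
          (g p.1 * (p.1 + β i).factorial * risingFactorial (B + 1) p.2)) * P) := by
      intro a ha
      have hai := Finset.ne_of_mem_erase ha
      rw [ih (fun k => g (k + if a = i then 1 else 0)) fun l => β l + if a = l then 1 else 0]
      have hsum : ∑ l ∈ Finset.univ.erase i, (((β l + if a = l then 1 else 0 : ℕ) : ℝ) + 1) =
          B + 1 := by
        push_cast
        simp only [hB, Finset.sum_add_distrib, Finset.sum_ite_eq, if_pos ha]
        ring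
      have hprod : ∏ l ∈ Finset.univ.erase i,
          (((β l + if a = l then 1 else 0).factorial : ℕ) : ℝ) = (β a + 1) * P := by
        rw [hP, ← Finset.mul_prod_erase _ _ ha, ← Finset.mul_prod_erase _ _ ha, ← mul_assoc]
        congr 1
        · simp [Nat.factorial_succ]
        · exact Finset.prod_congr rfl fun l hl => by simp [(Finset.ne_of_mem_erase hl).symm]
      rw [hsum, hprod]
      simp only [if_neg hai, add_zero]
      ring
    rw [cons_sum, ← Finset.add_sum_erase _ _ (Finset.mem_univ i), at_self,
      Finset.sum_congr rfl at_ne, ← Finset.sum_mul, ← hB,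
      Finset.sum_antidiagonal_choose_succ_mul
        (fun j e => g j * (j + β i).factorial * risingFactorial B e), ← mul_assoc, ← add_mul,
      add_comm]
    congr 2
    · rw [Finset.mul_sum]
      refine Finset.sum_congr rfl fun p _ => ?_
      rw [risingFactorial_succ']
      ring
    · refine Finset.sum_congr rfl fun p hp => ?_
      rw [Nat.choose_symm_of_eq_add (Finset.HasAntidiagonal.mem_antidiagonal.mp hp).symm]

/-- The vector `u ↦ (-1)^k C(n-1+d, k)` with `k` the number of letters `i` in `u` is, up to scaling,
dual to the word `i ⋯ i` for the form `(u, v) ↦ ∏ l, (k_l(u) + k_l(v))!`. -/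
lemma sum_dual_weight_mul_prod_factorial {n d : ℕ} (i : Fin n) (v : Fin d → Fin n) :
    ∑ u : Fin d → Fin n,
      (-1) ^ letterCount u i * ((n - 1 + d).choose (letterCount u i) : ℝ) *
        ∏ l, ((letterCount u l + letterCount v l).factorial : ℝ) =
      if v = (fun _ => i) then
        (-1) ^ d * (d.factorial : ℝ) ^ 2 * (n - 1 + d + d).choose d else 0 := by
  have hB : ∑ l ∈ Finset.univ.erase i, (letterCount v l + 1 : ℝ) =
      ((n - 1 + d : ℕ) : ℝ) - letterCount v i := by
    have h : (letterCount v i : ℝ) + ∑ l ∈ Finset.univ.erase i, (letterCount v l : ℝ) = d := by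
      rw [Finset.add_sum_erase _ (fun l => (letterCount v l : ℝ)) (Finset.mem_univ i)]
      exact_mod_cast sum_letterCount v
    rw [Finset.sum_add_distrib, Finset.sum_const, Finset.card_erase_of_mem (Finset.mem_univ i)]
    simp only [Finset.card_univ, Fintype.card_fin, nsmul_eq_mul, mul_one]
    push_cast
    linarith
  rw [sum_words_weight_mul_prod_factorial i (fun k => (-1) ^ k * ((n - 1 + d).choose k : ℝ)), hB,
    sum_choose_mul_choose_mul_factorial _ (letterCount_le v i)]
  simp only [letterCount_eq_length_iff]
  split_ifs with h
  · subst h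
    rw [Finset.prod_eq_one, mul_one]
    intro l hl
    simp [letterCount_const, (Finset.ne_of_mem_erase hl).symm]
  · simp

/-- The form `(u, v) ↦ ∏ l, (k_l(u) + k_l(v))!` on functions of words is positive semidefinite. -/
lemma sum_mul_prod_factorial_nonneg {n d : ℕ} (f : (Fin d → Fin n) → ℝ) :
    0 ≤ ∑ u, ∑ v, f u * f v *
      ∏ l, ((letterCount u l + letterCount v l).factorial : ℝ) := by
  set φ : (Fin n → ℕ) → (Fin d → Fin n) → ℝ := fun r u =>
    ∏ l, ((letterCount u l).factorial * (letterCount u l).choose (r l) : ℝ)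
  have hφ : ∀ u v : Fin d → Fin n,
      ∏ l, ((letterCount u l + letterCount v l).factorial : ℝ) =
        ∑ r ∈ Fintype.piFinset fun _ => Finset.range (d + 1), φ r u * φ r v := by
    intro u v
    simp only [φ, ← Finset.prod_mul_distrib]
    rw [Finset.sum_prod_piFinset (Finset.range (d + 1)) fun l r =>
      ((letterCount u l).factorial * (letterCount u l).choose r : ℝ) *
        ((letterCount v l).factorial * (letterCount v l).choose r)]
    refine Finset.prod_congr rfl fun l _ => ?_
    rw [← Nat.add_choose_mul_factorial_mul_factorial,
      add_choose_eq_sum_range _ _ (letterCount_le v l)]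
    push_cast
    rw [mul_assoc, Finset.sum_mul]
    refine Finset.sum_congr rfl fun r _ => ?_
    ring
  have hsq : ∑ u, ∑ v, f u * f v *
      ∏ l, ((letterCount u l + letterCount v l).factorial : ℝ) =
      ∑ r ∈ Fintype.piFinset fun _ => Finset.range (d + 1), (∑ u, f u * φ r u) ^ 2 := by
    simp only [hφ, sq, Finset.sum_mul_sum]
    rw [Finset.sum_comm (s := Fintype.piFinset fun _ => Finset.range (d + 1))]
    refine Finset.sum_congr rfl fun u _ => ?_
    rw [Finset.sum_comm (s := Fintype.piFinset fun _ => Finset.range (d + 1))]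
    refine Finset.sum_congr rfl fun v _ => ?_
    rw [Finset.mul_sum]
    exact Finset.sum_congr rfl fun r _ => by ring
  rw [hsq]
  exact Finset.sum_nonneg fun r _ => sq_nonneg _

lemma choose_mul_choose_mul_factorial_sq (a d : ℕ) :
    (a + d + d).choose d * (a + d).choose d * d.factorial ^ 2 =
      (a + 2 * d).choose (2 * d) * (2 * d).factorial := by
  have h₁ := Nat.add_choose_mul_factorial_mul_factorial (a + d) d
  have h₂ := Nat.add_choose_mul_factorial_mul_factorial a d
  have h₃ := Nat.add_choose_mul_factorial_mul_factorial a (2 * d)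
  refine Nat.eq_of_mul_eq_mul_right a.factorial_pos ?_
  calc _ = (a + d + d).choose d * ((a + d).choose d * a.factorial * d.factorial) *
        d.factorial := by ring
    _ = (a + 2 * d).factorial := by rw [h₂, h₁, add_assoc, two_mul]
    _ = _ := by rw [← h₃]; ring

lemma muConst_mul_factorial_mul_sum_sq_le {n d : ℕ} (hn : 2 ≤ n)
    (f : (Fin d → Fin n) → ℝ) :
    muConst n d * (2 * d).factorial * ∑ i : Fin n, f (fun _ => i) ^ 2 ≤
      ∑ u, ∑ v, f u * f v * ∏ l, ((letterCount u l + letterCount v l).factorial : ℝ) := by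
  set K : (Fin d → Fin n) → (Fin d → Fin n) → ℝ := fun u v =>
    ∏ l, ((letterCount u l + letterCount v l).factorial : ℝ) with hK
  have K_symm : ∀ u v, K u v = K v u := fun u v =>
    Finset.prod_congr rfl fun l _ => by rw [add_comm]
  set C : ℝ := (((n - 1 + d).choose d : ℕ) : ℝ) with hC
  set Δ : ℝ := if Odd d then 1 else ((n - 1 : ℕ) : ℝ) with hΔ
  set κ : ℝ := (d.factorial : ℝ) ^ 2 * (((n - 1 + d + d).choose d : ℕ) : ℝ) with hκ
  set ε : ℝ := (-1) ^ d with hε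
  have ε_sq : ε * ε = 1 := by rw [hε, ← mul_pow]; simp
  have C_pos : 0 < C := by
    rw [hC]
    exact_mod_cast Nat.choose_pos (Nat.le_add_left d (n - 1))
  have Δ_nonneg : 0 ≤ Δ := by rw [hΔ]; split_ifs <;> positivity
  have CΔ_pos : 0 < C + Δ := by positivity
  have κ_nonneg : 0 ≤ κ := by positivity
  have mu_eq : muConst n d * (2 * d).factorial = κ / (C + Δ) := by
    have h : (((n - 1 + 2 * d).choose (2 * d) : ℕ) : ℝ) * (2 * d).factorial = κ * C := by
      have := choose_mul_choose_mul_factorial_sq (n - 1) d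
      rw [hκ, hC]
      exact_mod_cast this.symm.trans (by ring)
    rw [muConst, if_neg (by omega), div_mul_eq_mul_div, h, mul_comm κ C,
      mul_div_mul_left _ _ C_pos.ne']
  set S : ℝ := ∑ i : Fin n, f (fun _ => i) ^ 2 with hS
  set t : Fin n → ℝ := fun i => ε / (C + Δ) * f (fun _ => i) with ht
  set q : Fin n → (Fin d → Fin n) → ℝ := fun i u =>
    (-1) ^ letterCount u i * ((n - 1 + d).choose (letterCount u i) : ℝ) with hq
  set g : (Fin d → Fin n) → ℝ := fun u => ∑ i, t i * q i u with hg
  have form_g : ∀ h : (Fin d → Fin n) → ℝ,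
      ∑ u, ∑ v, g u * h v * K u v = ε * κ * ∑ i, t i * h (fun _ => i) := by
    intro h
    have h_col : ∀ v, ∑ u, g u * K u v = ∑ i, t i * if v = (fun _ => i) then ε * κ else 0 := by
      intro v
      simp only [hg, Finset.sum_mul]
      rw [Finset.sum_comm]
      refine Finset.sum_congr rfl fun i _ => ?_
      have h_dual := sum_dual_weight_mul_prod_factorial i v
      rw [mul_assoc ((-1) ^ d)] at h_dual
      rw [← h_dual, Finset.mul_sum]
      exact Finset.sum_congr rfl fun u _ => mul_assoc _ _ _
    calc _ = ∑ v, h v * ∑ u, g u * K u v := by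
          rw [Finset.sum_comm]
          refine Finset.sum_congr rfl fun v _ => ?_
          rw [Finset.mul_sum]
          exact Finset.sum_congr rfl fun u _ => by ring
      _ = ∑ i, ∑ v, if v = (fun _ => i) then ε * κ * (t i * h v) else 0 := by
          rw [Finset.sum_comm]
          refine Finset.sum_congr rfl fun v _ => ?_
          rw [h_col, Finset.mul_sum]
          refine Finset.sum_congr rfl fun i _ => ?_
          split_ifs <;> ring
      _ = _ := by
          simp only [Finset.sum_ite_eq', Finset.mem_univ, if_true, Finset.mul_sum]
  have g_const : ∀ i, g (fun _ => i) = (ε * C - 1) * t i + ∑ j, t j := by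
    intro i
    have hqv : ∀ j, t j * q j (fun _ => i) =
        (if i = j then (ε * C - 1) * t j else 0) + t j := by
      intro j
      simp only [hq, letterCount_const]
      split_ifs
      · ring
      · simp
    simp only [hg, hqv, Finset.sum_add_distrib]
    simp
  have form_gg : ∑ u, ∑ v, g u * g v * K u v ≤ κ * (C + Δ) * ∑ i, t i ^ 2 := by
    have h : ∑ i, t i * g (fun _ => i) = (ε * C - 1) * ∑ i, t i ^ 2 + (∑ i, t i) ^ 2 := by
      simp only [g_const, mul_add, Finset.sum_add_distrib]
      rw [← Finset.sum_mul, ← sq, Finset.mul_sum]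
      congr 1
      exact Finset.sum_congr rfl fun i _ => by ring
    have key : (C - ε) * ∑ i, t i ^ 2 + ε * (∑ i, t i) ^ 2 ≤ (C + Δ) * ∑ i, t i ^ 2 := by
      by_cases hodd : Odd d
      · simp only [hε, hΔ, hodd.neg_one_pow, if_pos hodd]
        nlinarith [sq_nonneg (∑ i, t i)]
      · have hn' : ((n - 1 : ℕ) : ℝ) = n - 1 := by push_cast [show 1 ≤ n by omega]; ring
        have hcs := sq_sum_le_card_mul_sum_sq (s := Finset.univ) (f := t)
        simp only [Finset.card_univ, Fintype.card_fin] at hcs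
        simp only [hε, hΔ, (Nat.not_odd_iff_even.mp hodd).neg_one_pow, if_neg hodd, hn']
        nlinarith
    rw [form_g, h]
    calc _ = κ * ((ε * ε * C - ε) * ∑ i, t i ^ 2 + ε * (∑ i, t i) ^ 2) := by ring
      _ ≤ κ * ((C + Δ) * ∑ i, t i ^ 2) := by
        rw [ε_sq, one_mul]
        exact mul_le_mul_of_nonneg_left key κ_nonneg
      _ = _ := by ring
  have form_gf : ∑ u, ∑ v, g u * f v * K u v = κ / (C + Δ) * S := by
    rw [form_g, hS, Finset.mul_sum, Finset.mul_sum]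
    refine Finset.sum_congr rfl fun i _ => ?_
    simp only [ht]
    linear_combination κ / (C + Δ) * f (fun _ => i) ^ 2 * ε_sq
  have form_fg : ∑ u, ∑ v, f u * g v * K u v = ∑ u, ∑ v, g u * f v * K u v := by
    rw [Finset.sum_comm]
    refine Finset.sum_congr rfl fun u _ => Finset.sum_congr rfl fun v _ => ?_
    rw [K_symm, mul_comm (f v)]
  have sum_t_sq : κ * (C + Δ) * ∑ i, t i ^ 2 = κ / (C + Δ) * S := by
    rw [hS, Finset.mul_sum, Finset.mul_sum]
    refine Finset.sum_congr rfl fun i _ => ?_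
    simp only [ht]
    have : (C + Δ) * (C + Δ)⁻¹ = 1 := mul_inv_cancel₀ CΔ_pos.ne'
    simp only [div_eq_mul_inv]
    linear_combination κ * f (fun _ => i) ^ 2 * (C + Δ)⁻¹ *
      ((C + Δ) * (C + Δ)⁻¹ * ε_sq + this)
  have nonneg := sum_mul_prod_factorial_nonneg (f - g)
  have expand : ∑ u, ∑ v, (f - g) u * (f - g) v * K u v =
      ∑ u, ∑ v, f u * f v * K u v - ∑ u, ∑ v, f u * g v * K u v -
        ∑ u, ∑ v, g u * f v * K u v + ∑ u, ∑ v, g u * g v * K u v := by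
    simp only [← Finset.sum_sub_distrib, ← Finset.sum_add_distrib, Pi.sub_apply]
    exact Finset.sum_congr rfl fun u _ => Finset.sum_congr rfl fun v _ => by ring
  rw [mu_eq]
  change 0 ≤ ∑ u, ∑ v, (f - g) u * (f - g) v * K u v at nonneg
  rw [expand, form_fg, form_gf] at nonneg
  linarith

lemma muConst_formMatrix_posSemidef {n d : ℕ} (hn : 2 ≤ n) :
    (Matrix.of fun u v : Fin d → Fin n =>
      (∏ l, ((letterCount u l + letterCount v l).factorial : ℝ)) / (2 * d).factorial -
        muConst n d * ∑ j : Fin n,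
          if u = (fun _ => j) then if v = (fun _ => j) then 1 else 0 else 0).PosSemidef := by
  refine Matrix.PosSemidef.of_dotProduct_mulVec_nonneg ?_ fun f => ?_
  · ext u v
    simp only [Matrix.conjTranspose_apply, Matrix.of_apply, star_trivial]
    congr 2
    · exact Finset.prod_congr rfl fun l _ => by rw [add_comm]
    · refine Finset.sum_congr rfl fun j _ => ?_
      split_ifs <;> rfl
  · have h := muConst_mul_factorial_mul_sum_sq_le hn f
    have hF : (0 : ℝ) < (2 * d).factorial := by positivity
    have hsum : ∑ u : Fin d → Fin n, ∑ v : Fin d → Fin n, f u * f v * ∑ j : Fin n,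
        (if u = (fun _ => j) then if v = (fun _ => j) then (1 : ℝ) else 0 else 0) =
        ∑ j : Fin n, f (fun _ => j) ^ 2 := by
      simp only [Finset.mul_sum]
      rw [Finset.sum_congr rfl fun u _ => Finset.sum_comm, Finset.sum_comm]
      refine Finset.sum_congr rfl fun j _ => ?_
      simp [sq]
    have hform : star f ⬝ᵥ (Matrix.of fun u v : Fin d → Fin n =>
        (∏ l, ((letterCount u l + letterCount v l).factorial : ℝ)) / (2 * d).factorial -
        muConst n d * ∑ j : Fin n,
          if u = (fun _ => j) then if v = (fun _ => j) then 1 else 0 else 0) *ᵥ f =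
        (∑ u, ∑ v, f u * f v * ∏ l, ((letterCount u l + letterCount v l).factorial : ℝ)) /
          (2 * d).factorial - muConst n d * ∑ j : Fin n, f (fun _ => j) ^ 2 := by
      rw [← hsum]
      simp only [dotProduct, Matrix.mulVec, Matrix.of_apply, star_trivial, Pi.star_apply,
        Finset.sum_div, Finset.mul_sum (s := (Finset.univ : Finset (Fin d → Fin n))),
        ← Finset.sum_sub_distrib]
      exact Finset.sum_congr rfl fun u _ => Finset.sum_congr rfl fun v _ => by ring
    rw [hform, sub_nonneg, le_div_iff₀ hF]
    linarith

open scoped MatrixOrder in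
/-- A real positive semidefinite matrix produces positive semidefinite combinations of the
products `(A u)ᴴ * A v`. -/
lemma posSemidef_sum_smul_conjTranspose_mul {W : Type*} [Fintype W] {M : Matrix W W ℝ}
    (hM : M.PosSemidef) {k : ℕ} (A : W → Matrix (Fin k) (Fin k) ℂ) :
    (∑ u, ∑ v, M u v • ((A u)ᴴ * A v)).PosSemidef := by
  classical
  obtain ⟨B, rfl⟩ := CStarAlgebra.nonneg_iff_eq_star_mul_self.mp hM.nonneg
  have h : ∑ u, ∑ v, (star B * B) u v • ((A u)ᴴ * A v) =
      ∑ r, (∑ u, B r u • A u)ᴴ * ∑ v, B r v • A v := by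
    simp only [Matrix.conjTranspose_sum, Matrix.conjTranspose_smul, star_trivial,
      Finset.sum_mul_sum, Matrix.smul_mul, Matrix.mul_smul, smul_smul]
    rw [Finset.sum_comm (s := (Finset.univ : Finset W)) (t := (Finset.univ : Finset W))
      (f := fun r u => ∑ v, (B r v * B r u) • ((A u)ᴴ * A v))]
    refine Finset.sum_congr rfl fun u _ => ?_
    rw [Finset.sum_comm]
    refine Finset.sum_congr rfl fun v _ => ?_
    rw [← Finset.sum_smul]
    simp [Matrix.mul_apply, Matrix.star_eq_conjTranspose, mul_comm]
  rw [h]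
  exact Matrix.posSemidef_sum _ fun r _ => Matrix.posSemidef_conjTranspose_mul_self _

lemma wordProd_append {R : Type*} [Monoid R] {n d e : ℕ} (X : Fin n → R) (u : Fin d → Fin n)
    (v : Fin e → Fin n) : wordProd X (Fin.append u v) = wordProd X u * wordProd X v := by
  have h : (fun i => X (Fin.append u v i)) = Fin.append (fun i => X (u i)) fun i => X (v i) := by
    funext i
    refine Fin.addCases (fun i => ?_) (fun i => ?_) i <;> simp
  rw [wordProd, h, List.ofFn_fin_append, List.prod_append, wordProd, wordProd]

lemma wordProd_const {R : Type*} [Monoid R] {n d : ℕ} (X : Fin n → R) (j : Fin n) :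
    wordProd X (fun _ : Fin d => j) = X j ^ d := by
  simp [wordProd, List.ofFn_const]

lemma conjTranspose_wordProd {n d k : ℕ} {X : Fin n → Matrix (Fin k) (Fin k) ℂ}
    (hX : ∀ j, (X j).IsHermitian) (u : Fin d → Fin n) :
    (wordProd X u)ᴴ = wordProd X (u ∘ Fin.rev) := by
  rw [wordProd, wordProd, Matrix.conjTranspose_list_prod]
  congr 1
  refine List.ext_getElem (by simp) fun i h₁ h₂ => ?_
  simp [List.getElem_reverse, (hX _).eq, Fin.rev, Nat.sub_sub, add_comm]

lemma nchs_add_self {n d k : ℕ} {X : Fin n → Matrix (Fin k) (Fin k) ℂ}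
    (hX : ∀ j, (X j).IsHermitian) :
    nchs (d + d) X = ∑ u : Fin d → Fin n, ∑ v : Fin d → Fin n,
      ((∏ l, ((letterCount u l + letterCount v l).factorial : ℝ)) / (d + d).factorial) •
        ((wordProd X u)ᴴ * wordProd X v) := by
  rw [nchs, ← (Fin.appendEquiv d d).sum_comp, Fintype.sum_prod_type,
    ← (Fin.revPerm.arrowCongr (Equiv.refl (Fin n))).sum_comp]
  refine Finset.sum_congr rfl fun u _ => Finset.sum_congr rfl fun v _ => ?_
  have hu : (Fin.revPerm.arrowCongr (Equiv.refl (Fin n))) u = u ∘ Fin.rev := rfl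
  simp only [Fin.appendEquiv, Equiv.coe_fn_mk, hu, wordProd_append, conjTranspose_wordProd hX,
    nchsCoeff, letterCount_append, letterCount_comp_rev, Nat.cast_prod]

lemma nchs_one {R : Type*} [Ring R] [Module ℝ R] (d : ℕ) (X : Fin 1 → R) :
    nchs d X = X 0 ^ d := by
  have h : (default : Fin d → Fin 1) = fun _ => 0 := Subsingleton.elim _ _
  rw [nchs, Fintype.sum_unique, h, wordProd_const, nchsCoeff]
  simp [letterCount_const, Nat.factorial_ne_zero]

/-- `H_{2d}(X_1,…,X_n) ⪰ μ_{n,d} (X_1^{2d} + ⋯ + X_n^{2d})` for hermitian matrices. -/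
theorem stmt_2 (n d : ℕ) (hn : 1 ≤ n) (hd : 1 ≤ d) (k : ℕ)
    (X : Fin n → Matrix (Fin k) (Fin k) ℂ) (hX : ∀ j, (X j).IsHermitian) :
    (nchs (2 * d) X - muConst n d • ∑ j : Fin n, X j ^ (2 * d)).PosSemidef := by
  obtain rfl | hn : n = 1 ∨ 2 ≤ n := by omega
  · simpa [nchs_one, muConst] using Matrix.PosSemidef.zero
  convert! posSemidef_sum_smul_conjTranspose_mul (muConst_formMatrix_posSemidef hn) (wordProd X)
  simp only [Matrix.of_apply, sub_smul, Finset.sum_sub_distrib]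
  congr 1
  · rw [two_mul, nchs_add_self hX]
  · have h : ∀ u v : Fin d → Fin n, (muConst n d * ∑ j : Fin n,
        if u = (fun _ => j) then if v = (fun _ => j) then (1 : ℝ) else 0 else 0) •
          ((wordProd X u)ᴴ * wordProd X v) =
        muConst n d • ∑ j : Fin n, if u = (fun _ => j) then if v = (fun _ => j) then
          (wordProd X u)ᴴ * wordProd X v else 0 else 0 := by
      intro u v
      rw [mul_smul, Finset.sum_smul]
      congr 1
      refine Finset.sum_congr rfl fun j _ => ?_
      split_ifs <;> simp
    simp only [h, ← Finset.smul_sum]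
    congr 1
    rw [Finset.sum_congr rfl fun u _ => Finset.sum_comm, Finset.sum_comm]
    refine Finset.sum_congr rfl fun j _ => ?_
    simp [wordProd_const, Matrix.conjTranspose_pow, (hX j).eq, two_mul, pow_add]
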